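/- arXiv:1904.11839 — 11 statements merged into one kernel-verified Lean document; each statement's English description precedes it below -/
import Mathlib

section
/- Let Σ be a k×k real symmetric positive definite matrix, α ∈ ℝ^k a nonzero vector, and γ ≥ 0. For each positive integer n set S_n = (Σ + (γ/n)·I)⁻¹ and C_n(γ) = γ²·αᵀS_nα − (γ³/n)·αᵀS_n²α − 2γ·tr(S_n) + (γ²/n)·tr(S_n²). Then as n → ∞, C_n(γ) converges to C(γ) := (αᵀΣ⁻¹α)·γ² − 2·tr(Σ⁻¹)·γ; moreover the limit function C, restricted to γ ∈ [0,∞), attains its minimum uniquely at γ* = tr(Σ⁻¹)/(αᵀΣ⁻¹α), i.e. C(γ*) < C(γ) for every γ ≥ 0 with γ ≠ γ*. -/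
open Matrix Filter

/-- Inversion is continuous along a scalar perturbation of an invertible matrix. -/
theorem tendsto_inv_add_smul_one {ι m : Type*} [Fintype m] [DecidableEq m] {l : Filter ι}
    {A : Matrix m m ℝ} (hA : A.det ≠ 0) {u : ι → ℝ} (hu : Tendsto u l (nhds 0)) :
    Tendsto (fun i => (A + u i • (1 : Matrix m m ℝ))⁻¹) l (nhds A⁻¹) := by
  have hcont : ContinuousAt Inv.inv A := by
    apply continuousAt_matrix_inv
    rw [Ring.inverse_eq_inv']
    exact continuousAt_inv₀ hA
  have hadd : Tendsto (fun i => A + u i • (1 : Matrix m m ℝ)) l (nhds A) := by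
    simpa using tendsto_const_nhds.add (hu.smul_const (1 : Matrix m m ℝ))
  exact hcont.tendsto.comp hadd

/-- A quadratic `a g² - 2 t g` with `a > 0` has `t / a` as its unique minimizer. -/
theorem quadratic_lt_of_ne_div {a t g : ℝ} (ha : 0 < a) (hg : g ≠ t / a) :
    a * (t / a) ^ 2 - 2 * t * (t / a) < a * g ^ 2 - 2 * t * g := by
  have hpos : 0 < a * (g - t / a) ^ 2 := by
    have : g - t / a ≠ 0 := sub_ne_zero.mpr hg
    positivity
  have hsq : a * g ^ 2 - 2 * t * g - (a * (t / a) ^ 2 - 2 * t * (t / a))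
      = a * (g - t / a) ^ 2 := by
    field_simp
    ring
  linarith

/-- Deterministic core of the asymptotically optimal regularization
gain result: the (renormalized) risk functions `C_n` converge pointwise to the
quadratic `C(γ) = (αᵀΣ⁻¹α)γ² − 2 tr(Σ⁻¹) γ`, whose unique minimizer over `[0,∞)`
is `γ* = tr(Σ⁻¹)/(αᵀΣ⁻¹α)`. -/
theorem stmt_0 {k : ℕ} (Sg : Matrix (Fin k) (Fin k) ℝ) (hSg : Sg.PosDef)
    (α : Fin k → ℝ) (hα : α ≠ 0) (γ : ℝ) (hγ : 0 ≤ γ)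
    (S : ℕ → Matrix (Fin k) (Fin k) ℝ)
    (hS : ∀ n : ℕ, S n = (Sg + (γ / n) • (1 : Matrix (Fin k) (Fin k) ℝ))⁻¹)
    (Cn : ℕ → ℝ)
    (hCn : ∀ n : ℕ, Cn n =
      γ ^ 2 * (α ⬝ᵥ (S n) *ᵥ α) - (γ ^ 3 / n) * (α ⬝ᵥ (S n * S n) *ᵥ α)
        - 2 * γ * (S n).trace + (γ ^ 2 / n) * (S n * S n).trace)
    (C : ℝ → ℝ)
    (hC : ∀ g : ℝ, C g = (α ⬝ᵥ Sg⁻¹ *ᵥ α) * g ^ 2 - 2 * Sg⁻¹.trace * g)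
    (γstar : ℝ) (hγstar : γstar = Sg⁻¹.trace / (α ⬝ᵥ Sg⁻¹ *ᵥ α)) :
    Tendsto Cn atTop (nhds (C γ)) ∧
      ∀ g : ℝ, 0 ≤ g → g ≠ γstar → C γstar < C g := by
  have hS_tendsto : Tendsto S atTop (nhds Sg⁻¹) := by
    rw [funext hS]
    exact tendsto_inv_add_smul_one hSg.det_pos.ne' (tendsto_const_div_atTop_nhds_zero_nat γ)
  have hquad : Continuous fun M : Matrix (Fin k) (Fin k) ℝ => α ⬝ᵥ M *ᵥ α := by fun_prop
  have htrace : Continuous fun M : Matrix (Fin k) (Fin k) ℝ => M.trace := by fun_prop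
  have hSS := hS_tendsto.mul hS_tendsto
  constructor
  · rw [funext hCn, hC]
    have hlim := ((((hquad.tendsto _).comp hS_tendsto).const_mul (γ ^ 2)).sub
      ((tendsto_const_div_atTop_nhds_zero_nat (γ ^ 3)).mul ((hquad.tendsto _).comp hSS))).sub
      (((htrace.tendsto _).comp hS_tendsto).const_mul (2 * γ)) |>.add
      ((tendsto_const_div_atTop_nhds_zero_nat (γ ^ 2)).mul ((htrace.tendsto _).comp hSS))
    convert hlim using 2
    · rfl
    · ring
  · intro g _ hg
    have hpos : 0 < α ⬝ᵥ Sg⁻¹ *ᵥ α := by simpa using hSg.inv.dotProduct_mulVec_pos hα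
    subst hγstar
    rw [hC, hC]
    exact quadratic_lt_of_ne_div hpos hg
end

section
/- Let A be a real M×k matrix, W a symmetric positive definite real M×M matrix, and L a real k×M matrix with L·A = I (the k×k identity). Then AᵀWA is invertible and the matrix L·W⁻¹·Lᵀ − (AᵀWA)⁻¹ is positive semidefinite. (Hence the weighted least squares estimate with weight W has the smallest mean squared error matrix among all linear unbiased estimators, whose MSE matrices are exactly the matrices L·W⁻¹·Lᵀ with L·A = I.) -/
open Matrix

/-- Gauss–Markov optimality of the weighted least squares
estimate: if `W` is symmetric positive definite and `L·A = I`, then `AᵀWA` is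
invertible and `L·W⁻¹·Lᵀ − (AᵀWA)⁻¹` is positive semidefinite. -/
theorem stmt_2 {M k : ℕ} (A : Matrix (Fin M) (Fin k) ℝ)
    (W : Matrix (Fin M) (Fin M) ℝ) (hW : W.PosDef)
    (L : Matrix (Fin k) (Fin M) ℝ) (hL : L * A = 1) :
    IsUnit (Aᵀ * W * A) ∧ (L * W⁻¹ * Lᵀ - (Aᵀ * W * A)⁻¹).PosSemidef := by
  have hA : Function.Injective A.mulVec := fun x y hxy => by
    simpa [mulVec_mulVec, hL] using congrArg (L *ᵥ ·) hxy
  have hG : (Aᵀ * W * A).PosDef := by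
    simpa using hW.conjTranspose_mul_mul_same hA
  refine ⟨hG.isUnit, ?_⟩
  have hWdet : IsUnit W.det := (isUnit_iff_isUnit_det W).1 hW.isUnit
  have hGdet := (isUnit_iff_isUnit_det _).1 hG.isUnit
  have hWt : Wᵀ = W := by simpa using hW.isHermitian.eq
  have hGit : ((Aᵀ * W * A)⁻¹)ᵀ = (Aᵀ * W * A)⁻¹ := by simpa using hG.inv.isHermitian.eq
  have hALt : Aᵀ * Lᵀ = 1 := by rw [← transpose_mul, hL, transpose_one]
  have hGG : (Aᵀ * W * A)⁻¹ * (Aᵀ * W * A) = 1 := nonsing_inv_mul _ hGdet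
  -- The difference is the covariance of `L` minus the weighted least squares estimator.
  have hD := hW.inv.posSemidef.mul_mul_conjTranspose_same (L - (Aᵀ * W * A)⁻¹ * Aᵀ * W)
  suffices h : L * W⁻¹ * Lᵀ - (Aᵀ * W * A)⁻¹ =
      (L - (Aᵀ * W * A)⁻¹ * Aᵀ * W) * W⁻¹ * (L - (Aᵀ * W * A)⁻¹ * Aᵀ * W)ᴴ by
    rw [h]
    exact hD
  generalize (Aᵀ * W * A)⁻¹ = H at hGit hGG ⊢
  have hcross : (L - H * Aᵀ * W) * W⁻¹ = L * W⁻¹ - H * Aᵀ := by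
    rw [Matrix.sub_mul, mul_nonsing_inv_cancel_right _ _ hWdet]
  have ht : (L - H * Aᵀ * W)ᵀ = Lᵀ - W * (A * H) := by
    simp [transpose_sub, transpose_mul, hGit, hWt]
  have h₁ : L * W⁻¹ * (W * (A * H)) = H := by
    rw [← Matrix.mul_assoc, nonsing_inv_mul_cancel_right _ _ hWdet, ← Matrix.mul_assoc, hL,
      Matrix.one_mul]
  have h₂ : H * Aᵀ * Lᵀ = H := by rw [Matrix.mul_assoc, hALt, Matrix.mul_one]
  have h₃ : H * Aᵀ * (W * (A * H)) = H := by
    rw [show H * Aᵀ * (W * (A * H)) = H * (Aᵀ * W * A) * H by simp only [Matrix.mul_assoc],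
      hGG, Matrix.one_mul]
  rw [conjTranspose_eq_transpose_of_trivial, hcross, ht, Matrix.sub_mul, Matrix.mul_sub,
    Matrix.mul_sub, h₁, h₂, h₃, sub_self, sub_zero]
end

section
/- Assume A has full column rank k and let t ∈ ℝ^k be nonzero. Put C = (AᵀA)⁻¹, θ̂^LS = C Aᵀ y, and θ̂^CLS = θ̂^LS − (C t)·(tᵀθ̂^LS − 1)/(tᵀ C t). Then for every y ∈ ℝ^M: tᵀθ̂^CLS = 1, and for every ϑ ∈ ℝ^k with tᵀϑ = 1 one has (y − Aθ̂^CLS)ᵀ(y − Aθ̂^CLS) ≤ (y − Aϑ)ᵀ(y − Aϑ), with equality only when ϑ = θ̂^CLS. That is, θ̂^CLS is the unique minimizer of the least squares cost over the affine constraint set {ϑ : tᵀϑ = 1}. -/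
open Matrix

theorem Matrix.mulVec_injective_of_rank_eq_card {m n K : Type*} [Fintype m] [Fintype n] [Field K]
    {A : Matrix m n K} (hA : A.rank = Fintype.card n) : Function.Injective A.mulVec := by
  rw [Matrix.mulVec_injective_iff, linearIndependent_iff_card_eq_finrank_span, ← hA,
    Matrix.rank_eq_finrank_span_cols]
  rfl

/-- If the residual of `θ` is orthogonal to `A *ᵥ (ϑ - θ)`, the least squares cost of `ϑ` is that
of `θ` plus the squared length of `A *ᵥ (ϑ - θ)`. -/
theorem Matrix.residual_dotProduct_self_eq_add {m n R : Type*} [Fintype m] [Fintype n] [CommRing R]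
    (A : Matrix m n R) (y : m → R) (θ ϑ : n → R)
    (h : (y - A *ᵥ θ) ⬝ᵥ A *ᵥ (ϑ - θ) = 0) :
    (y - A *ᵥ ϑ) ⬝ᵥ (y - A *ᵥ ϑ) =
      (y - A *ᵥ θ) ⬝ᵥ (y - A *ᵥ θ) + A *ᵥ (ϑ - θ) ⬝ᵥ A *ᵥ (ϑ - θ) := by
  have hsplit : y - A *ᵥ ϑ = (y - A *ᵥ θ) - A *ᵥ (ϑ - θ) := by
    rw [mulVec_sub]; abel
  have h_comm : A *ᵥ (ϑ - θ) ⬝ᵥ (y - A *ᵥ θ) = 0 := (dotProduct_comm _ _).trans h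
  rw [hsplit, sub_dotProduct, dotProduct_sub _ (y - A *ᵥ θ),
    dotProduct_sub _ (y - A *ᵥ θ) (A *ᵥ (ϑ - θ)), h, h_comm]
  ring

/-- Closed form of the constrained least squares estimate:
`θ̂^CLS = θ̂^LS − (C t)(tᵀθ̂^LS − 1)/(tᵀ C t)` with `C = (AᵀA)⁻¹` satisfies the
constraint `tᵀθ̂^CLS = 1` and is the unique minimizer of the least squares
cost over the affine set `{ϑ : tᵀϑ = 1}`. -/
theorem stmt_3 {M k : ℕ} (A : Matrix (Fin M) (Fin k) ℝ) (hA : A.rank = k)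
    (t : Fin k → ℝ) (ht : t ≠ 0)
    (C : Matrix (Fin k) (Fin k) ℝ) (hC : C = (Aᵀ * A)⁻¹)
    (θLS : (Fin M → ℝ) → Fin k → ℝ)
    (hθLS : ∀ y, θLS y = (C * Aᵀ) *ᵥ y)
    (θCLS : (Fin M → ℝ) → Fin k → ℝ)
    (hθCLS : ∀ y, θCLS y =
      θLS y - ((t ⬝ᵥ θLS y - 1) / (t ⬝ᵥ C *ᵥ t)) • (C *ᵥ t)) :
    ∀ y : Fin M → ℝ,
      t ⬝ᵥ θCLS y = 1 ∧
      ∀ ϑ : Fin k → ℝ, t ⬝ᵥ ϑ = 1 →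
        ((y - A *ᵥ θCLS y) ⬝ᵥ (y - A *ᵥ θCLS y) ≤
            (y - A *ᵥ ϑ) ⬝ᵥ (y - A *ᵥ ϑ)) ∧
        ((y - A *ᵥ θCLS y) ⬝ᵥ (y - A *ᵥ θCLS y) =
            (y - A *ᵥ ϑ) ⬝ᵥ (y - A *ᵥ ϑ) → ϑ = θCLS y) := by
  intro y
  have hinj : Function.Injective A.mulVec :=
    Matrix.mulVec_injective_of_rank_eq_card (by simpa using hA)
  have hpos : (Aᵀ * A).PosDef := by
    simpa using Matrix.PosDef.conjTranspose_mul_self A hinj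
  have hGC : (Aᵀ * A) * C = 1 := by
    rw [hC]
    exact Matrix.mul_nonsing_inv _ ((Matrix.isUnit_iff_isUnit_det _).mp hpos.isUnit)
  have htCt : 0 < t ⬝ᵥ C *ᵥ t := by
    simpa [hC] using hpos.inv.dotProduct_mulVec_pos ht
  have hfeas : t ⬝ᵥ θCLS y = 1 := by
    rw [hθCLS, dotProduct_sub, dotProduct_smul, smul_eq_mul, div_mul_cancel₀ _ htCt.ne']
    ring
  have hresid : Aᵀ *ᵥ (y - A *ᵥ θCLS y) = ((t ⬝ᵥ θLS y - 1) / (t ⬝ᵥ C *ᵥ t)) • t := by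
    have hLS : (Aᵀ * A) *ᵥ θLS y = Aᵀ *ᵥ y := by
      rw [hθLS, mulVec_mulVec, ← Matrix.mul_assoc, hGC, Matrix.one_mul]
    rw [mulVec_sub, mulVec_mulVec, hθCLS, mulVec_sub, hLS, mulVec_smul, mulVec_mulVec, hGC,
      one_mulVec, sub_sub_cancel]
  refine ⟨hfeas, fun ϑ hϑ ↦ ?_⟩
  have horth : (y - A *ᵥ θCLS y) ⬝ᵥ A *ᵥ (ϑ - θCLS y) = 0 := by
    rw [dotProduct_mulVec, ← mulVec_transpose, hresid, smul_dotProduct, dotProduct_sub, hϑ, hfeas,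
      sub_self, smul_zero]
  rw [Matrix.residual_dotProduct_self_eq_add A y (θCLS y) ϑ horth]
  refine ⟨le_add_of_nonneg_right (by simpa using dotProduct_star_self_nonneg (A *ᵥ (ϑ - θCLS y))),
    fun heq ↦ ?_⟩
  have hzero : A *ᵥ (ϑ - θCLS y) = 0 := dotProduct_self_eq_zero.mp (left_eq_add.mp heq)
  exact sub_eq_zero.mp (hinj (hzero.trans (mulVec_zero A).symm))
end

section
/- Assume A has full column rank k, W is symmetric positive definite, and t ∈ ℝ^k is nonzero. Let C = (AᵀWA)⁻¹ and F = C − C t tᵀ C/(tᵀ C t). Suppose H is a real k×M matrix and f ∈ ℝ^k satisfy the unbiasedness condition H·A·ϑ + f = ϑ for every ϑ ∈ ℝ^k with tᵀϑ = 1. Then the matrix H·W⁻¹·Hᵀ − F is positive semidefinite. (Hence the constrained weighted least squares estimate is optimal among all affine estimators Hy + f that are unbiased on the constraint set, whose MSE matrices are exactly H·W⁻¹·Hᵀ.) -/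
open Matrix

/-- A linear map `B` with `B ϑ + f = ϑ` on the affine hyperplane `tᵀϑ = 1` is `1 - f tᵀ`. -/
lemma Matrix.eq_one_sub_vecMulVec_of_mulVec_add_eq {n 𝕜 : Type*} [Fintype n] [DecidableEq n]
    [Field 𝕜] [LinearOrder 𝕜] [IsStrictOrderedRing 𝕜] (B : Matrix n n 𝕜) {t : n → 𝕜}
    (ht : t ≠ 0) (f : n → 𝕜) (h : ∀ v : n → 𝕜, t ⬝ᵥ v = 1 → B *ᵥ v + f = v) :
    B = 1 - vecMulVec f t := by
  have htt : t ⬝ᵥ t ≠ 0 := fun h0 => ht (dotProduct_self_eq_zero.mp h0)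
  set w : n → 𝕜 := (t ⬝ᵥ t)⁻¹ • t with hw
  have htw : t ⬝ᵥ w = 1 := by
    rw [hw, dotProduct_smul, smul_eq_mul, inv_mul_cancel₀ htt]
  refine ext_of_mulVec_single fun i => ?_
  set v : n → 𝕜 := Pi.single i 1
  have h1 := h w htw
  have h2 := h (v + (1 - t ⬝ᵥ v) • w) (by
    rw [dotProduct_add, dotProduct_smul, htw, smul_eq_mul]; ring)
  rw [mulVec_add, mulVec_smul] at h2
  rw [sub_mulVec, one_mulVec, vecMulVec_mulVec]
  ext j
  have h1j := congrFun h1 j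
  have h2j := congrFun h2 j
  simp only [Pi.add_apply, Pi.sub_apply, Pi.smul_apply, smul_eq_mul, MulOpposite.smul_eq_mul_unop,
    MulOpposite.unop_op] at h1j h2j ⊢
  linear_combination h2j - (1 - t ⬝ᵥ v) * h1j

/-- **optimality part of Theorem 1.** Among all affine
estimators `Hy + f` that are unbiased on the constraint set `{ϑ : tᵀϑ = 1}`,
i.e. `HAϑ + f = ϑ` for all such `ϑ`, the MSE matrix `H W⁻¹ Hᵀ` dominates
`F = C − C t tᵀ C/(tᵀ C t)` with `C = (AᵀWA)⁻¹`: the difference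
`H W⁻¹ Hᵀ − F` is positive semidefinite. -/
theorem stmt_6 {M k : ℕ} (A : Matrix (Fin M) (Fin k) ℝ) (hA : A.rank = k)
    (W : Matrix (Fin M) (Fin M) ℝ) (hW : W.PosDef)
    (t : Fin k → ℝ) (ht : t ≠ 0)
    (C F : Matrix (Fin k) (Fin k) ℝ) (hC : C = (Aᵀ * W * A)⁻¹)
    (hF : F = C - (t ⬝ᵥ C *ᵥ t)⁻¹ • (C * vecMulVec t t * C))
    (H : Matrix (Fin k) (Fin M) ℝ) (f : Fin k → ℝ)
    (hunbiased : ∀ ϑ : Fin k → ℝ, t ⬝ᵥ ϑ = 1 → (H * A) *ᵥ ϑ + f = ϑ) :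
    (H * W⁻¹ * Hᵀ - F).PosSemidef := by
  have hinj : Function.Injective A.mulVec := by
    rw [mulVec_injective_iff, linearIndependent_iff_card_eq_finrank_span, Set.finrank,
      ← rank_eq_finrank_span_cols, hA, Fintype.card_fin]
  have hN : (Aᵀ * W * A).PosDef := by
    simpa only [conjTranspose_eq_transpose_of_trivial] using hW.conjTranspose_mul_mul_same hinj
  have hCpos : C.PosDef := hC ▸ hN.inv
  have hNC : (Aᵀ * W * A) * C = 1 := by
    rw [hC, mul_nonsing_inv _ ((isUnit_iff_isUnit_det _).mp hN.isUnit)]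
  have hCT : Cᵀ = C := by
    simpa only [conjTranspose_eq_transpose_of_trivial] using hCpos.isHermitian.eq
  have hWT : Wᵀ = W := by
    simpa only [conjTranspose_eq_transpose_of_trivial] using hW.isHermitian.eq
  have hWdet : IsUnit W.det := (isUnit_iff_isUnit_det _).mp hW.isUnit
  have hc : t ⬝ᵥ C *ᵥ t ≠ 0 := by
    simpa only [star_trivial] using (hCpos.dotProduct_mulVec_pos ht).ne'
  have hFT : Fᵀ = F := by
    simp only [hF, transpose_sub, transpose_smul, transpose_mul, transpose_vecMulVec, hCT,
      Matrix.mul_assoc]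
  have hFt : F *ᵥ t = 0 := by
    have hrank_one : (C * vecMulVec t t * C) *ᵥ t = (t ⬝ᵥ C *ᵥ t) • C *ᵥ t := by
      rw [← mulVec_mulVec, ← mulVec_mulVec, vecMulVec_mulVec, op_smul_eq_smul, mulVec_smul]
    rw [hF, sub_mulVec, smul_mulVec, hrank_one, smul_smul, inv_mul_cancel₀ hc, one_smul, sub_self]
  have htF : t ᵥ* F = 0 := by
    rw [← mulVec_transpose, hFT, hFt]
  have hHAF : H * A * F = F := by
    rw [(H * A).eq_one_sub_vecMulVec_of_mulVec_add_eq ht f hunbiased, Matrix.sub_mul,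
      Matrix.one_mul, vecMulVec_mul, htF, vecMulVec_zero, sub_zero]
  have hFNF : F * (Aᵀ * W * A) * F = F := by
    have hNF : (Aᵀ * W * A) * F = 1 - (t ⬝ᵥ C *ᵥ t)⁻¹ • (vecMulVec t t * C) := by
      rw [hF, Matrix.mul_sub, hNC, Matrix.mul_smul, Matrix.mul_assoc C, ← Matrix.mul_assoc _ C,
        hNC, Matrix.one_mul]
    rw [Matrix.mul_assoc, hNF, Matrix.mul_sub, Matrix.mul_one, Matrix.mul_smul,
      ← Matrix.mul_assoc, mul_vecMulVec, hFt, zero_vecMulVec, Matrix.zero_mul, smul_zero, sub_zero]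
  have hGT : (F * Aᵀ * W)ᵀ = W * (A * F) := by
    rw [transpose_mul, transpose_mul, transpose_transpose, hFT, hWT]
  have hcross : H * W⁻¹ * (F * Aᵀ * W)ᵀ = F := by
    rw [hGT, Matrix.mul_assoc, nonsing_inv_mul_cancel_left _ _ hWdet, ← Matrix.mul_assoc, hHAF]
  have hcross' : F * Aᵀ * W * W⁻¹ * Hᵀ = F := by
    rw [mul_nonsing_inv_cancel_right _ _ hWdet, Matrix.mul_assoc, ← transpose_mul]
    simpa only [transpose_mul, hFT] using congrArg transpose hHAF
  have hsq : F * Aᵀ * W * W⁻¹ * (F * Aᵀ * W)ᵀ = F := by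
    rw [hGT, mul_nonsing_inv_cancel_right _ _ hWdet]
    simpa only [Matrix.mul_assoc] using hFNF
  have key : H * W⁻¹ * Hᵀ - F = (H - F * Aᵀ * W) * W⁻¹ * (H - F * Aᵀ * W)ᵀ := by
    rw [transpose_sub, Matrix.sub_mul, Matrix.mul_sub, Matrix.sub_mul, Matrix.sub_mul, hcross,
      hcross', hsq, sub_self, sub_zero]
  rw [key, ← conjTranspose_eq_transpose_of_trivial (H - F * Aᵀ * W)]
  exact hW.inv.posSemidef.mul_mul_conjTranspose_same _
end

section
/- Let A be a real M×k matrix (no rank condition), W a symmetric positive definite real M×M matrix, t ∈ ℝ^k nonzero, and γ > 0. Put C = (AᵀWA + γI)⁻¹ (which exists), θ̂^RWLS = C Aᵀ W y, and θ̂^CRWLS = θ̂^RWLS − (C t)·(tᵀθ̂^RWLS − 1)/(tᵀ C t). Then for every y ∈ ℝ^M, tᵀθ̂^CRWLS = 1 and θ̂^CRWLS is the unique minimizer of the regularized weighted cost (y − Aϑ)ᵀ W (y − Aϑ) + γ‖ϑ‖² over the constraint set {ϑ ∈ ℝ^k : tᵀϑ = 1}, where ‖·‖ is the Euclidean norm.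 -/
open Matrix

/-- The normal matrix of ridge-regularized weighted least squares is positive definite. -/
lemma Matrix.PosDef.transpose_mul_mul_add_smul_one {m n : Type*} [Fintype m] [Fintype n]
    [DecidableEq n] {W : Matrix m m ℝ} (hW : W.PosDef) (A : Matrix m n ℝ) {γ : ℝ} (hγ : 0 < γ) :
    (Aᵀ * W * A + γ • (1 : Matrix n n ℝ)).PosDef := by
  have hA : (Aᵀ * W * A).PosSemidef := by
    simpa using hW.posSemidef.conjTranspose_mul_mul_same A
  exact Matrix.PosDef.posSemidef_add hA (Matrix.PosDef.one.smul hγ)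

/-- Second-order expansion of the ridge-regularized weighted cost around `θ`. -/
lemma Matrix.IsSymm.regularized_cost_add {m n : Type*} [Fintype m] [Fintype n] [DecidableEq n]
    {W : Matrix m m ℝ} (hW : W.IsSymm) (A : Matrix m n ℝ) (γ : ℝ) (y : m → ℝ) (θ d : n → ℝ) :
    (y - A *ᵥ (θ + d)) ⬝ᵥ W *ᵥ (y - A *ᵥ (θ + d)) + γ * ((θ + d) ⬝ᵥ (θ + d)) =
      (y - A *ᵥ θ) ⬝ᵥ W *ᵥ (y - A *ᵥ θ) + γ * (θ ⬝ᵥ θ) +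
        2 * (d ⬝ᵥ ((Aᵀ * W * A + γ • (1 : Matrix n n ℝ)) *ᵥ θ - (Aᵀ * W) *ᵥ y)) +
        d ⬝ᵥ (Aᵀ * W * A + γ • (1 : Matrix n n ℝ)) *ᵥ d := by
  have hsymm (u v : m → ℝ) : u ⬝ᵥ W *ᵥ v = v ⬝ᵥ W *ᵥ u := by
    rw [dotProduct_mulVec, ← mulVec_transpose, hW.eq, dotProduct_comm]
  have hadj (v : m → ℝ) : d ⬝ᵥ Aᵀ *ᵥ v = (A *ᵥ d) ⬝ᵥ v := by
    rw [dotProduct_mulVec, vecMul_transpose]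
  simp only [add_mulVec, mulVec_add, mulVec_sub, smul_mulVec, one_mulVec, ← mulVec_mulVec,
    dotProduct_add, add_dotProduct, dotProduct_sub, sub_dotProduct, dotProduct_smul, smul_eq_mul,
    hadj]
  rw [hsymm y (A *ᵥ d), hsymm (A *ᵥ θ) (A *ᵥ d), dotProduct_comm θ d]
  ring

/-- **Theorem 2, closed form.** For any measurement matrix `A`
(no rank condition), symmetric positive definite `W`, nonzero `t`, and
regularization parameter `γ > 0`, the estimate
`θ̂^CRWLS = θ̂^RWLS − (C t)(tᵀθ̂^RWLS − 1)/(tᵀ C t)` with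
`C = (AᵀWA + γI)⁻¹`, `θ̂^RWLS = C Aᵀ W y`, satisfies the constraint and is
the unique minimizer of the regularized weighted cost
`(y − Aϑ)ᵀW(y − Aϑ) + γ‖ϑ‖²` over `{ϑ : tᵀϑ = 1}`. -/
theorem stmt_7 {M k : ℕ} (A : Matrix (Fin M) (Fin k) ℝ)
    (W : Matrix (Fin M) (Fin M) ℝ) (hW : W.PosDef)
    (t : Fin k → ℝ) (ht : t ≠ 0) (γ : ℝ) (hγ : 0 < γ)
    (C : Matrix (Fin k) (Fin k) ℝ)
    (hC : C = (Aᵀ * W * A + γ • (1 : Matrix (Fin k) (Fin k) ℝ))⁻¹)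
    (θRWLS θCRWLS : (Fin M → ℝ) → Fin k → ℝ)
    (hθRWLS : ∀ y, θRWLS y = (C * Aᵀ * W) *ᵥ y)
    (hθCRWLS : ∀ y, θCRWLS y =
      θRWLS y - ((t ⬝ᵥ θRWLS y - 1) / (t ⬝ᵥ C *ᵥ t)) • (C *ᵥ t)) :
    ∀ y : Fin M → ℝ,
      t ⬝ᵥ θCRWLS y = 1 ∧
      ∀ ϑ : Fin k → ℝ, t ⬝ᵥ ϑ = 1 → ϑ ≠ θCRWLS y →
        (y - A *ᵥ θCRWLS y) ⬝ᵥ W *ᵥ (y - A *ᵥ θCRWLS y)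
            + γ * (θCRWLS y ⬝ᵥ θCRWLS y) <
          (y - A *ᵥ ϑ) ⬝ᵥ W *ᵥ (y - A *ᵥ ϑ) + γ * (ϑ ⬝ᵥ ϑ) := by
  intro y
  set H := Aᵀ * W * A + γ • (1 : Matrix (Fin k) (Fin k) ℝ) with hH
  have hHpos : H.PosDef := hW.transpose_mul_mul_add_smul_one A hγ
  have hHC : H * C = 1 := by
    rw [hC]
    exact mul_nonsing_inv H ((isUnit_iff_isUnit_det H).mp hHpos.isUnit)
  have htCt : 0 < t ⬝ᵥ C *ᵥ t := by
    rw [hC]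
    simpa using hHpos.inv.dotProduct_mulVec_pos ht
  have hconstr : t ⬝ᵥ θCRWLS y = 1 := by
    rw [hθCRWLS, dotProduct_sub, dotProduct_smul, smul_eq_mul, div_mul_cancel₀ _ htCt.ne']
    ring
  refine ⟨hconstr, fun ϑ hϑ hne => ?_⟩
  obtain ⟨d, rfl⟩ : ∃ d, ϑ = θCRWLS y + d := ⟨ϑ - θCRWLS y, by abel⟩
  have hd : d ≠ 0 := by simpa using hne
  have htd : d ⬝ᵥ t = 0 := by
    rw [dotProduct_add, hconstr] at hϑ
    rw [dotProduct_comm]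
    linarith
  have hgrad : d ⬝ᵥ (H *ᵥ θCRWLS y - (Aᵀ * W) *ᵥ y) = 0 := by
    rw [hθCRWLS, hθRWLS, mulVec_sub, mulVec_smul, mulVec_mulVec, mulVec_mulVec,
      Matrix.mul_assoc C, ← Matrix.mul_assoc H, hHC, Matrix.one_mul, one_mulVec]
    simp [htd]
  have hquad : 0 < d ⬝ᵥ H *ᵥ d := by
    simpa using hHpos.dotProduct_mulVec_pos hd
  have hWsymm : W.IsSymm := by
    simpa [IsHermitian, IsSymm] using hW.isHermitian
  rw [hWsymm.regularized_cost_add, ← hH, hgrad]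
  linarith
end

section
/- Assume A has full column rank k, W is symmetric positive definite, t ∈ ℝ^k is nonzero, tᵀθ = 1, and ‖θ‖² > 1/‖t‖². Let C₀ = (AᵀWA)⁻¹, F₀ = C₀ − C₀ t tᵀ C₀/(tᵀ C₀ t); for γ with 0 < γ < 2/(‖θ‖² − 1/‖t‖²), let C_γ = (AᵀWA + γI)⁻¹, F_γ = C_γ − C_γ t tᵀ C_γ/(tᵀ C_γ t), and M_γ = F_γ − γ·F_γ·(I − γθθᵀ)·F_γ. Then the difference D = F₀ − M_γ is positive semidefinite and satisfies xᵀDx > 0 for every x ∈ ℝ^k that is not a scalar multiple of t. (F₀ is the MSE matrix of the constrained weighted LSE and M_γ that of the constrained regularized weighted LSE, so regularization with such γ strictly decreases the MSE on the constraint directions.) -/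
open Matrix

/-- The matrix `N⁻¹ - N⁻¹ t tᵀ N⁻¹ / (tᵀ N⁻¹ t)`, whose range is the hyperplane orthogonal
to `t`. -/
noncomputable def constrainedInv {n : Type*} [Fintype n] [DecidableEq n]
    (N : Matrix n n ℝ) (t : n → ℝ) : Matrix n n ℝ :=
  N⁻¹ - (t ⬝ᵥ N⁻¹ *ᵥ t)⁻¹ • (N⁻¹ * vecMulVec t t * N⁻¹)

section constrainedInv

variable {n : Type*} [Fintype n] [DecidableEq n] {N G : Matrix n n ℝ} {t : n → ℝ}

theorem transpose_constrainedInv (hN : Nᵀ = N) :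
    (constrainedInv N t)ᵀ = constrainedInv N t := by
  simp [constrainedInv, transpose_nonsing_inv, hN, transpose_vecMulVec, Matrix.mul_assoc]

theorem constrainedInv_mulVec (hN : Nᵀ = N) (x : n → ℝ) :
    constrainedInv N t *ᵥ x =
      N⁻¹ *ᵥ x - ((t ⬝ᵥ N⁻¹ *ᵥ t)⁻¹ * (x ⬝ᵥ N⁻¹ *ᵥ t)) • N⁻¹ *ᵥ t := by
  have h : t ⬝ᵥ N⁻¹ *ᵥ x = x ⬝ᵥ N⁻¹ *ᵥ t := by
    rw [dotProduct_mulVec, ← mulVec_transpose, transpose_nonsing_inv, hN, dotProduct_comm]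
  simp only [constrainedInv, sub_mulVec, smul_mulVec, ← mulVec_mulVec, vecMulVec_mulVec, h,
    mulVec_smul, op_smul_eq_smul, smul_smul]

theorem dotProduct_constrainedInv_mulVec (hN : N.PosDef) (ht : t ≠ 0) (x : n → ℝ) :
    t ⬝ᵥ constrainedInv N t *ᵥ x = 0 := by
  have hsymm : Nᵀ = N := by simpa using hN.isHermitian.eq
  have hpos : 0 < t ⬝ᵥ N⁻¹ *ᵥ t := by simpa using hN.inv.dotProduct_mulVec_pos ht
  have h : t ⬝ᵥ N⁻¹ *ᵥ x = x ⬝ᵥ N⁻¹ *ᵥ t := by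
    rw [dotProduct_mulVec, ← mulVec_transpose, transpose_nonsing_inv, hsymm, dotProduct_comm]
  rw [constrainedInv_mulVec hsymm, dotProduct_sub, dotProduct_smul, h, smul_eq_mul]
  field_simp
  ring

theorem exists_eq_mulVec_constrainedInv_add_smul (hN : N.PosDef) (x : n → ℝ) :
    ∃ c : ℝ, x = N *ᵥ (constrainedInv N t *ᵥ x) + c • t := by
  have hsymm : Nᵀ = N := by simpa using hN.isHermitian.eq
  have hu : IsUnit N.det := (isUnit_iff_isUnit_det N).1 hN.isUnit
  refine ⟨(t ⬝ᵥ N⁻¹ *ᵥ t)⁻¹ * (x ⬝ᵥ N⁻¹ *ᵥ t), ?_⟩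
  rw [constrainedInv_mulVec hsymm, mulVec_sub, mulVec_smul, mulVec_mulVec, mulVec_mulVec,
    mul_nonsing_inv _ hu, one_mulVec, one_mulVec, sub_add_cancel]

/-- On the hyperplane orthogonal to `t`, the concave function `u ↦ 2 xᵀu - uᵀNu` is bounded
by `xᵀ (constrainedInv N t) x`. -/
theorem two_mul_dotProduct_sub_le_constrainedInv (hN : N.PosDef) (ht : t ≠ 0)
    (x u : n → ℝ) (hu : t ⬝ᵥ u = 0) :
    2 * (x ⬝ᵥ u) - u ⬝ᵥ N *ᵥ u ≤ x ⬝ᵥ constrainedInv N t *ᵥ x := by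
  have hsymm : Nᵀ = N := by simpa using hN.isHermitian.eq
  obtain ⟨c, hc⟩ := exists_eq_mulVec_constrainedInv_add_smul (t := t) hN x
  have hv := dotProduct_constrainedInv_mulVec hN ht x
  set v := constrainedInv N t *ᵥ x
  have hxv : x ⬝ᵥ v = v ⬝ᵥ N *ᵥ v := by
    conv_lhs => rw [hc]
    rw [add_dotProduct, smul_dotProduct, hv, smul_zero, add_zero, dotProduct_comm]
  have hxu : x ⬝ᵥ u = u ⬝ᵥ N *ᵥ v := by
    rw [hc, add_dotProduct, smul_dotProduct, hu, smul_zero, add_zero, dotProduct_comm]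
  have hvu : v ⬝ᵥ N *ᵥ u = u ⬝ᵥ N *ᵥ v := by
    rw [dotProduct_mulVec, ← mulVec_transpose, hsymm, dotProduct_comm]
  have hnonneg : 0 ≤ (v - u) ⬝ᵥ N *ᵥ (v - u) := by
    simpa using hN.posSemidef.dotProduct_mulVec_nonneg (v - u)
  simp only [mulVec_sub, sub_dotProduct, dotProduct_sub, hvu] at hnonneg
  linarith

/-- Regularizing `G` by `γ` increases the quadratic form of `constrainedInv` by at least
`γ ‖u‖²`, where `u = constrainedInv (G + γ) t x`. -/
theorem constrainedInv_add_smul_one_add_le (hG : G.PosDef) (ht : t ≠ 0) {γ : ℝ}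
    (hN : (G + γ • (1 : Matrix n n ℝ)).PosDef) (x : n → ℝ) :
    x ⬝ᵥ constrainedInv (G + γ • 1) t *ᵥ x
      + γ * ((constrainedInv (G + γ • 1) t *ᵥ x) ⬝ᵥ constrainedInv (G + γ • 1) t *ᵥ x)
      ≤ x ⬝ᵥ constrainedInv G t *ᵥ x := by
  obtain ⟨c, hc⟩ := exists_eq_mulVec_constrainedInv_add_smul (t := t) hN x
  have hu := dotProduct_constrainedInv_mulVec hN ht x
  set u := constrainedInv (G + γ • 1) t *ᵥ x
  have hxu : x ⬝ᵥ u = u ⬝ᵥ G *ᵥ u + γ * (u ⬝ᵥ u) := by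
    conv_lhs => rw [hc]
    rw [add_dotProduct, smul_dotProduct, hu, smul_zero, add_zero, dotProduct_comm, add_mulVec,
      dotProduct_add, smul_mulVec, one_mulVec, dotProduct_smul, smul_eq_mul]
  have := two_mul_dotProduct_sub_le_constrainedInv hG ht x u hu
  linarith

end constrainedInv

/-- Cauchy–Schwarz on the hyperplane orthogonal to `t`. -/
theorem sq_dotProduct_le_of_orthogonal {n : Type*} [Fintype n] {t θ u : n → ℝ} (ht : t ≠ 0)
    (hθ : t ⬝ᵥ θ = 1) (hu : t ⬝ᵥ u = 0) :
    (θ ⬝ᵥ u) ^ 2 ≤ (θ ⬝ᵥ θ - (t ⬝ᵥ t)⁻¹) * (u ⬝ᵥ u) := by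
  have htt : t ⬝ᵥ t ≠ 0 := by simpa using ht
  have h := Finset.sum_mul_sq_le_sq_mul_sq Finset.univ (θ - (t ⬝ᵥ t)⁻¹ • t) u
  have hqu : (θ - (t ⬝ᵥ t)⁻¹ • t) ⬝ᵥ u = θ ⬝ᵥ u := by simp [sub_dotProduct, hu]
  have hqq : (θ - (t ⬝ᵥ t)⁻¹ • t) ⬝ᵥ (θ - (t ⬝ᵥ t)⁻¹ • t) = θ ⬝ᵥ θ - (t ⬝ᵥ t)⁻¹ := by
    simp only [sub_dotProduct, dotProduct_sub, smul_dotProduct, dotProduct_smul, smul_eq_mul,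
      dotProduct_comm θ t, hθ]
    field_simp
    ring
  rw [← hqu, ← hqq]
  simpa only [dotProduct, sq] using h

theorem mulVec_injective_of_rank_eq {m : Type*} [Fintype m] {k : ℕ}
    {A : Matrix m (Fin k) ℝ} (hA : A.rank = k) : Function.Injective A.mulVec := by
  rw [mulVec_injective_iff, linearIndependent_iff_card_eq_finrank_span, Set.finrank,
    ← rank_eq_finrank_span_cols, hA, Fintype.card_fin]

/-- **Theorem 5.** For `0 < γ < 2/(‖θ‖² − 1/‖t‖²)` the MSE
matrix `M_γ = F_γ − γ F_γ (I − γ θθᵀ) F_γ` of the constrained regularized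
weighted LSE is dominated by the MSE matrix `F₀` of the constrained weighted
LSE: the difference `D = F₀ − M_γ` is positive semidefinite and
`xᵀDx > 0` whenever `x` is not a scalar multiple of `t`. -/
theorem stmt_9 {M k : ℕ} (A : Matrix (Fin M) (Fin k) ℝ) (hA : A.rank = k)
    (W : Matrix (Fin M) (Fin M) ℝ) (hW : W.PosDef)
    (t : Fin k → ℝ) (ht : t ≠ 0)
    (θ : Fin k → ℝ) (hθ : t ⬝ᵥ θ = 1)
    (hθnorm : (t ⬝ᵥ t)⁻¹ < θ ⬝ᵥ θ)
    (γ : ℝ) (hγ0 : 0 < γ) (hγ2 : γ < 2 / (θ ⬝ᵥ θ - (t ⬝ᵥ t)⁻¹))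
    (C₀ F₀ Cγ Fγ Mγ D : Matrix (Fin k) (Fin k) ℝ)
    (hC₀ : C₀ = (Aᵀ * W * A)⁻¹)
    (hF₀ : F₀ = C₀ - (t ⬝ᵥ C₀ *ᵥ t)⁻¹ • (C₀ * vecMulVec t t * C₀))
    (hCγ : Cγ = (Aᵀ * W * A + γ • (1 : Matrix (Fin k) (Fin k) ℝ))⁻¹)
    (hFγ : Fγ = Cγ - (t ⬝ᵥ Cγ *ᵥ t)⁻¹ • (Cγ * vecMulVec t t * Cγ))
    (hMγ : Mγ = Fγ - γ • (Fγ * ((1 : Matrix (Fin k) (Fin k) ℝ)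
      - γ • vecMulVec θ θ) * Fγ))
    (hD : D = F₀ - Mγ) :
    D.PosSemidef ∧
      ∀ x : Fin k → ℝ, (¬∃ c : ℝ, x = c • t) → 0 < x ⬝ᵥ D *ᵥ x := by
  have hG : (Aᵀ * W * A).PosDef := by
    simpa using hW.conjTranspose_mul_mul_same (mulVec_injective_of_rank_eq hA)
  set G := Aᵀ * W * A
  have hN : (G + γ • (1 : Matrix (Fin k) (Fin k) ℝ)).PosDef := hG.add (PosDef.one.smul hγ0)
  have hGsymm : Gᵀ = G := by simpa using hG.isHermitian.eq
  have hNsymm : (G + γ • (1 : Matrix (Fin k) (Fin k) ℝ))ᵀ = G + γ • 1 := by simp [hGsymm]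
  replace hF₀ : F₀ = constrainedInv G t := by rw [hF₀, hC₀, constrainedInv]
  replace hFγ : Fγ = constrainedInv (G + γ • 1) t := by rw [hFγ, hCγ, constrainedInv]
  have hFsymm : Fγᵀ = Fγ := hFγ ▸ transpose_constrainedInv hNsymm
  have hF₀symm : F₀ᵀ = F₀ := hF₀ ▸ transpose_constrainedInv hGsymm
  have hDsymm : Dᵀ = D := by
    simp [hD, hMγ, hFsymm, hF₀symm, transpose_vecMulVec, Matrix.mul_assoc]
  have hquad (x : Fin k → ℝ) : x ⬝ᵥ D *ᵥ x = x ⬝ᵥ F₀ *ᵥ x - x ⬝ᵥ Fγ *ᵥ x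
      + γ * ((Fγ *ᵥ x) ⬝ᵥ Fγ *ᵥ x) - γ ^ 2 * (θ ⬝ᵥ Fγ *ᵥ x) ^ 2 := by
    have hself (y : Fin k → ℝ) : x ⬝ᵥ Fγ *ᵥ y = (Fγ *ᵥ x) ⬝ᵥ y := by
      rw [dotProduct_mulVec, ← mulVec_transpose, hFsymm]
    simp only [hD, hMγ, sub_mulVec, dotProduct_sub, smul_mulVec, dotProduct_smul,
      ← mulVec_mulVec, one_mulVec, vecMulVec_mulVec, mulVec_sub, mulVec_smul, op_smul_eq_smul,
      smul_eq_mul, hself, dotProduct_comm (Fγ *ᵥ x) θ]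
    ring
  have hgap : 0 < 2 - γ * (θ ⬝ᵥ θ - (t ⬝ᵥ t)⁻¹) :=
    sub_pos.2 ((lt_div_iff₀ (sub_pos.2 hθnorm)).1 hγ2)
  have hlower (x : Fin k → ℝ) :
      γ * (2 - γ * (θ ⬝ᵥ θ - (t ⬝ᵥ t)⁻¹)) * ((Fγ *ᵥ x) ⬝ᵥ Fγ *ᵥ x) ≤ x ⬝ᵥ D *ᵥ x := by
    have hle := constrainedInv_add_smul_one_add_le hG ht hN x
    have hort := dotProduct_constrainedInv_mulVec hN ht x
    rw [← hFγ] at hle hort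
    rw [← hF₀] at hle
    have hcs := mul_le_mul_of_nonneg_left (sq_dotProduct_le_of_orthogonal ht hθ hort)
      (sq_nonneg γ)
    rw [hquad]
    linarith
  have hnonneg (u : Fin k → ℝ) : 0 ≤ u ⬝ᵥ u := by
    simpa using dotProduct_star_self_nonneg u
  refine ⟨.of_dotProduct_mulVec_nonneg (by simpa [IsHermitian] using hDsymm) fun x ↦ ?_,
    fun x hx ↦ ?_⟩
  · rw [star_trivial]
    exact (mul_nonneg (mul_pos hγ0 hgap).le (hnonneg _)).trans (hlower x)
  · refine (mul_pos (mul_pos hγ0 hgap) ((hnonneg _).lt_of_ne' fun h ↦ hx ?_)).trans_le (hlower x)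
    obtain ⟨c, hc⟩ := exists_eq_mulVec_constrainedInv_add_smul (t := t) hN x
    rw [← hFγ, dotProduct_self_eq_zero.1 h, mulVec_zero, zero_add] at hc
    exact ⟨c, hc⟩
end

section
/- Let k = m+1, let A be a real M×k matrix, W symmetric positive definite, t ∈ ℝ^k nonzero, and γ > 0. Let Q be a real orthogonal k×k matrix (QᵀQ = I) whose row indexed 0 equals tᵀ/‖t‖. Write A·Qᵀ = [d, K], i.e. d ∈ ℝ^M is column 0 of AQᵀ and K is the M×m matrix of the remaining columns. For y ∈ ℝ^M set z = y − d/‖t‖ and α̂^RWLS = (KᵀWK + γI)⁻¹ Kᵀ W z. Let θ̂^CRWLS = C Aᵀ W y − (C t)·(tᵀ C Aᵀ W y − 1)/(tᵀ C t) with C = (AᵀWA + γI)⁻¹. Then Q·θ̂^CRWLS has component 1/‖t‖ at index 0 and components α̂^RWLS at the remaining indices; equivalently, θ̂^CRWLS = Qᵀ·(1/‖t‖, α̂^RWLS). -/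
open Matrix

theorem posDef_transpose_mul_mul_add_smul_one {ι κ : Type*} [Fintype ι] [Fintype κ]
    [DecidableEq κ] {W : Matrix ι ι ℝ} (hW : W.PosSemidef) (B : Matrix ι κ ℝ)
    {γ : ℝ} (hγ : 0 < γ) : (Bᵀ * W * B + γ • (1 : Matrix κ κ ℝ)).PosDef := by
  have h := hW.conjTranspose_mul_mul_same B
  rw [conjTranspose_eq_transpose_of_trivial] at h
  exact PosDef.posSemidef_add h (PosDef.one.smul hγ)

/-- **Proposition 4.** Under the orthogonal change of
coordinates `Q` (row 0 proportional to `t`) eliminating the constraint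
`tᵀθ = 1`, the constrained regularized weighted LSE `θ̂^CRWLS` corresponds to
the regularized weighted LSE `α̂^RWLS` of the reduced model:
`Q θ̂^CRWLS = (1/‖t‖, α̂^RWLS)`. -/
theorem stmt_11 {M m : ℕ} (A : Matrix (Fin M) (Fin (m + 1)) ℝ)
    (W : Matrix (Fin M) (Fin M) ℝ) (hW : W.PosDef)
    (t : Fin (m + 1) → ℝ) (ht : t ≠ 0) (γ : ℝ) (hγ : 0 < γ)
    (Q : Matrix (Fin (m + 1)) (Fin (m + 1)) ℝ) (hQ : Qᵀ * Q = 1)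
    (hQrow : ∀ j, Q 0 j = t j / Real.sqrt (t ⬝ᵥ t))
    (d : Fin M → ℝ) (hd : ∀ j, d j = (A * Qᵀ) j 0)
    (K : Matrix (Fin M) (Fin m) ℝ) (hK : ∀ j i, K j i = (A * Qᵀ) j i.succ)
    (z : (Fin M → ℝ) → Fin M → ℝ)
    (hz : ∀ y, z y = y - (Real.sqrt (t ⬝ᵥ t))⁻¹ • d)
    (αRWLS : (Fin M → ℝ) → Fin m → ℝ)
    (hαRWLS : ∀ y, αRWLS y =
      ((Kᵀ * W * K + γ • (1 : Matrix (Fin m) (Fin m) ℝ))⁻¹ * Kᵀ * W) *ᵥ z y)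
    (C : Matrix (Fin (m + 1)) (Fin (m + 1)) ℝ)
    (hC : C = (Aᵀ * W * A + γ • (1 : Matrix (Fin (m + 1)) (Fin (m + 1)) ℝ))⁻¹)
    (θCRWLS : (Fin M → ℝ) → Fin (m + 1) → ℝ)
    (hθCRWLS : ∀ y, θCRWLS y = (C * Aᵀ * W) *ᵥ y -
      ((t ⬝ᵥ (C * Aᵀ * W) *ᵥ y - 1) / (t ⬝ᵥ C *ᵥ t)) • (C *ᵥ t)) :
    ∀ y : Fin M → ℝ,
      Q *ᵥ θCRWLS y = Fin.cons ((Real.sqrt (t ⬝ᵥ t))⁻¹) (αRWLS y) := by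
  intro y
  set s := Real.sqrt (t ⬝ᵥ t)
  have htt : 0 < t ⬝ᵥ t := by simpa using dotProduct_star_self_pos_iff.2 ht
  have hs0 : s ≠ 0 := (Real.sqrt_pos.2 htt).ne'
  set G := Aᵀ * W * A + γ • (1 : Matrix (Fin (m + 1)) (Fin (m + 1)) ℝ) with hG
  have hGpos : G.PosDef := posDef_transpose_mul_mul_add_smul_one hW.posSemidef A hγ
  have hGC : G * C = 1 := by
    rw [hC]; exact mul_nonsing_inv _ ((isUnit_iff_isUnit_det _).1 hGpos.isUnit)
  have hCpos : C.PosDef := hC ▸ hGpos.inv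
  have htCt : t ⬝ᵥ C *ᵥ t ≠ 0 := by
    simpa using (hCpos.dotProduct_mulVec_pos ht).ne'
  have hθt : t ⬝ᵥ θCRWLS y = 1 := by
    rw [hθCRWLS, dotProduct_sub, dotProduct_smul, smul_eq_mul, div_mul_cancel₀ _ htCt]
    ring
  obtain ⟨c, hc⟩ : ∃ c : ℝ, G *ᵥ θCRWLS y = Aᵀ *ᵥ W *ᵥ y - c • t := by
    refine ⟨(t ⬝ᵥ (C * Aᵀ * W) *ᵥ y - 1) / (t ⬝ᵥ C *ᵥ t), ?_⟩
    rw [hθCRWLS, mulVec_sub, mulVec_smul, mulVec_mulVec, mulVec_mulVec, mulVec_mulVec, hGC,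
      one_mulVec, ← Matrix.mul_assoc, ← Matrix.mul_assoc, hGC, Matrix.one_mul]
  have ht_row : t = s • Q 0 := by
    ext j
    rw [Pi.smul_apply, hQrow, smul_eq_mul, mul_div_cancel₀ _ hs0]
  have hQQ : Q * Qᵀ = 1 := mul_eq_one_comm.1 hQ
  have hQt (i : Fin m) : (Q *ᵥ t) i.succ = 0 := by
    have h : (Q *ᵥ Q 0) i.succ = (Q * Qᵀ) i.succ 0 := rfl
    rw [ht_row, mulVec_smul, Pi.smul_apply, h, hQQ, one_apply_ne (Fin.succ_ne_zero i), smul_zero]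
  set β := Q *ᵥ θCRWLS y with hβ
  have hβ0 : β 0 = s⁻¹ := by
    have h : s * β 0 = 1 := by
      rw [← hθt]
      conv_rhs => rw [ht_row, smul_dotProduct]
      rfl
    exact eq_inv_of_mul_eq_one_right h
  have hAθ : A *ᵥ θCRWLS y = s⁻¹ • d + K *ᵥ Fin.tail β := by
    have h : A *ᵥ θCRWLS y = (A * Qᵀ) *ᵥ β := by
      rw [hβ, mulVec_mulVec, Matrix.mul_assoc, hQ, Matrix.mul_one]
    rw [h]
    ext j
    simp only [mulVec, dotProduct, Fin.sum_univ_succ, ← hd, ← hK, hβ0, Pi.add_apply,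
      Pi.smul_apply, smul_eq_mul, Fin.tail]
    ring
  have hQA (v : Fin M → ℝ) : Fin.tail (Q *ᵥ Aᵀ *ᵥ v) = Kᵀ *ᵥ v := by
    have h : Q * Aᵀ = (A * Qᵀ)ᵀ := by simp
    rw [mulVec_mulVec, h]
    ext i
    simp only [Fin.tail, mulVec, dotProduct, transpose_apply, hK]
  have hnormal : Kᵀ *ᵥ W *ᵥ (s⁻¹ • d + K *ᵥ Fin.tail β) + γ • Fin.tail β = Kᵀ *ᵥ W *ᵥ y := by
    rw [← hAθ, ← hQA, ← hQA]
    have h := congrArg (Q *ᵥ ·) hc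
    simp only [hG, add_mulVec, smul_mulVec, one_mulVec, mulVec_add, mulVec_sub, mulVec_smul,
      ← mulVec_mulVec] at h
    ext i
    have hi := congrFun h i.succ
    simp only [Pi.add_apply, Pi.sub_apply, Pi.smul_apply, hQt, smul_zero, sub_zero] at hi
    exact hi
  set H := Kᵀ * W * K + γ • (1 : Matrix (Fin m) (Fin m) ℝ) with hH
  have hHpos : H.PosDef := posDef_transpose_mul_mul_add_smul_one hW.posSemidef K hγ
  have hHβ : H *ᵥ Fin.tail β = Kᵀ *ᵥ W *ᵥ z y := by
    rw [hz, mulVec_sub, mulVec_sub, ← hnormal, hH, add_mulVec, smul_mulVec, one_mulVec,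
      mulVec_add, mulVec_add, ← mulVec_mulVec, ← mulVec_mulVec]
    abel
  have htail : Fin.tail β = αRWLS y := by
    rw [hαRWLS, ← mulVec_mulVec, ← mulVec_mulVec, ← hHβ, mulVec_mulVec,
      nonsing_inv_mul _ ((isUnit_iff_isUnit_det _).1 hHpos.isUnit), one_mulVec]
  rw [← htail, ← hβ0, Fin.cons_self_tail]
end

section
/- Let K be a real M×m matrix of full column rank m, W a symmetric positive definite real M×M matrix, and α ∈ ℝ^m nonzero. For 0 < γ < 2/‖α‖² (Euclidean norm), set V = (KᵀWK + γI)⁻¹. Then the matrix (KᵀWK)⁻¹ − (γ²·V α αᵀ V + V KᵀWK V) is positive definite. (That is, the MSE matrix of the regularized weighted LSE with such γ is strictly smaller, in the Loewner order, than the MSE matrix (KᵀWK)⁻¹ of the unregularized weighted LSE.) -/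
open Matrix

theorem Matrix.mulVec_injective_of_rank_eq_card_s13 {ι κ F : Type*} [Fintype κ] [Field F]
    {K : Matrix ι κ F} (hK : K.rank = Fintype.card κ) : Function.Injective K.mulVec := by
  rw [mulVec_injective_iff, linearIndependent_iff_card_eq_finrank_span,
    Set.finrank, ← rank_eq_finrank_span_cols, hK]

theorem Matrix.posSemidef_two_smul_one_sub_smul_vecMulVec {n : Type*} [Fintype n] [DecidableEq n]
    (α : n → ℝ) {γ : ℝ} (hγ0 : 0 ≤ γ) (hγ2 : γ * (α ⬝ᵥ α) ≤ 2) :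
    ((2 : ℝ) • (1 : Matrix n n ℝ) - γ • vecMulVec α α).PosSemidef := by
  refine .of_dotProduct_mulVec_nonneg ?_ fun x ↦ ?_
  · simp [IsHermitian, conjTranspose_eq_transpose_of_trivial, transpose_vecMulVec]
  · have cauchy : (α ⬝ᵥ x) ^ 2 ≤ (α ⬝ᵥ α) * (x ⬝ᵥ x) := by
      simpa only [dotProduct, sq] using Finset.sum_mul_sq_le_sq_mul_sq Finset.univ α x
    have hx : 0 ≤ x ⬝ᵥ x := by
      simpa using dotProduct_star_self_nonneg x
    have key : star x ⬝ᵥ ((2 : ℝ) • (1 : Matrix n n ℝ) - γ • vecMulVec α α) *ᵥ x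
        = 2 * (x ⬝ᵥ x) - γ * (α ⬝ᵥ x) ^ 2 := by
      simp [sub_mulVec, smul_mulVec, vecMulVec_mulVec, dotProduct_comm x α, sq]
    rw [key]
    nlinarith [mul_le_mul_of_nonneg_left cauchy hγ0, mul_le_mul_of_nonneg_right hγ2 hx]

/-- **Remark 4.** In the reduced model, for
`0 < γ < 2/‖α‖²` the MSE matrix `γ² V ααᵀ V + V KᵀWK V` of the regularized
weighted LSE (with `V = (KᵀWK + γI)⁻¹`) is strictly smaller in the Loewner
order than the MSE matrix `(KᵀWK)⁻¹` of the unregularized weighted LSE. -/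
theorem stmt_13 {M m : ℕ} (K : Matrix (Fin M) (Fin m) ℝ) (hK : K.rank = m)
    (W : Matrix (Fin M) (Fin M) ℝ) (hW : W.PosDef)
    (α : Fin m → ℝ) (hα : α ≠ 0)
    (γ : ℝ) (hγ0 : 0 < γ) (hγ2 : γ < 2 / (α ⬝ᵥ α))
    (V : Matrix (Fin m) (Fin m) ℝ)
    (hV : V = (Kᵀ * W * K + γ • (1 : Matrix (Fin m) (Fin m) ℝ))⁻¹) :
    ((Kᵀ * W * K)⁻¹ -
      (γ ^ 2 • (V * vecMulVec α α * V) + V * (Kᵀ * W * K) * V)).PosDef := by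
  have hA : (Kᵀ * W * K).PosDef := by
    simpa [conjTranspose_eq_transpose_of_trivial] using
      hW.conjTranspose_mul_mul_same
        (mulVec_injective_of_rank_eq_card_s13 (hK.trans (Fintype.card_fin m).symm))
  generalize Kᵀ * W * K = A at *
  have hS : (A + γ • (1 : Matrix (Fin m) (Fin m) ℝ)).PosDef := hA.add (PosDef.one.smul hγ0)
  have hVpos : V.PosDef := hV ▸ hS.inv
  have hα0 : 0 < α ⬝ᵥ α := by simpa using dotProduct_star_self_pos_iff.mpr hα
  have hN := posSemidef_two_smul_one_sub_smul_vecMulVec α hγ0.le ((lt_div_iff₀ hα0).mp hγ2).le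
  have hP := (hA.inv.smul (sq_pos_of_pos hγ0)).add_posSemidef (hN.smul hγ0.le)
  have hAdet := (isUnit_iff_isUnit_det A).mp hA.isUnit
  have hSdet := (isUnit_iff_isUnit_det _).mp hS.isUnit
  have hVS : V * (A + γ • 1) = 1 := hV ▸ nonsing_inv_mul _ hSdet
  have hSV : (A + γ • 1) * V = 1 := hV ▸ mul_nonsing_inv _ hSdet
  have expand : (A + γ • 1) * A⁻¹ * (A + γ • 1) = A + (2 * γ) • 1 + γ ^ 2 • A⁻¹ := by
    simp only [add_mul, mul_add, smul_mul_assoc, mul_smul_comm, one_mul, mul_one,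
      mul_nonsing_inv A hAdet, nonsing_inv_mul A hAdet]
    module
  have inv_eq : A⁻¹ = V * (A + (2 * γ) • 1 + γ ^ 2 • A⁻¹) * V := by
    rw [← expand, ← mul_assoc, ← mul_assoc, hVS, one_mul, mul_assoc, hSV, mul_one]
  have key : A⁻¹ - (γ ^ 2 • (V * vecMulVec α α * V) + V * A * V) =
      star V * (γ ^ 2 • A⁻¹ + γ • ((2 : ℝ) • 1 - γ • vecMulVec α α)) * V := by
    rw [star_eq_conjTranspose, hVpos.isHermitian.eq]
    nth_rewrite 1 [inv_eq]
    simp only [add_mul, mul_add, sub_mul, mul_sub, smul_mul_assoc, mul_smul_comm, smul_sub]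
    module
  rw [key]
  exact (IsUnit.posDef_star_left_conjugate_iff hVpos.isUnit).mpr hP
end

section
/- Let k = m+1, A a real M×k matrix, W symmetric positive definite, t ∈ ℝ^k nonzero, γ > 0, and θ ∈ ℝ^k with tᵀθ = 1. Let Q be a real orthogonal k×k matrix whose row indexed 0 equals tᵀ/‖t‖; write A·Qᵀ = [d, K] (d the column indexed 0, K the M×m matrix of remaining columns), and let α ∈ ℝ^m be the vector of components (Qθ)_i for i ≠ 0. For y ∈ ℝ^M put z = y − d/‖t‖, α̂^RWLS = (KᵀWK + γI)⁻¹KᵀW z, and θ̂^CRWLS = C AᵀW y − (C t)(tᵀC AᵀW y − 1)/(tᵀC t) with C = (AᵀWA + γI)⁻¹. Then A·θ − A·θ̂^CRWLS = K·α − K·α̂^RWLS. -/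
open Matrix

/-- The regularized weighted Gram matrix is positive definite. -/
lemma posDef_weightedGram_add_smul_one {M n : ℕ} (B : Matrix (Fin M) (Fin n) ℝ)
    {W : Matrix (Fin M) (Fin M) ℝ} (hW : W.PosDef) {γ : ℝ} (hγ : 0 < γ) :
    (Bᵀ * W * B + γ • (1 : Matrix (Fin n) (Fin n) ℝ)).PosDef := by
  have h := hW.posSemidef.conjTranspose_mul_mul_same B
  rw [conjTranspose_eq_transpose_of_trivial] at h
  exact PosDef.posSemidef_add h (PosDef.one.smul hγ)

/-- Splitting off the zeroth coordinate after an orthogonal change of variables. -/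
lemma mulVec_eq_smul_add_mulVec_tail {M m : ℕ} (A : Matrix (Fin M) (Fin (m + 1)) ℝ)
    {Q : Matrix (Fin (m + 1)) (Fin (m + 1)) ℝ} (hQ : Qᵀ * Q = 1)
    {d : Fin M → ℝ} (hd : ∀ j, d j = (A * Qᵀ) j 0)
    {K : Matrix (Fin M) (Fin m) ℝ} (hK : ∀ j i, K j i = (A * Qᵀ) j i.succ)
    (x : Fin (m + 1) → ℝ) :
    A *ᵥ x = (Q *ᵥ x) 0 • d + K *ᵥ fun i => (Q *ᵥ x) i.succ := by
  have h : A *ᵥ x = (A * Qᵀ) *ᵥ (Q *ᵥ x) := by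
    rw [mulVec_mulVec, Matrix.mul_assoc, hQ, Matrix.mul_one]
  rw [h]
  ext j
  simp only [mulVec, dotProduct, Pi.add_apply, Pi.smul_apply, smul_eq_mul, hd, hK]
  rw [Fin.sum_univ_succ, mul_comm]

lemma transpose_mulVec_eq_tail {M m : ℕ} (A : Matrix (Fin M) (Fin (m + 1)) ℝ)
    (Q : Matrix (Fin (m + 1)) (Fin (m + 1)) ℝ)
    {K : Matrix (Fin M) (Fin m) ℝ} (hK : ∀ j i, K j i = (A * Qᵀ) j i.succ)
    (v : Fin M → ℝ) (i : Fin m) :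
    (Kᵀ *ᵥ v) i = (Q *ᵥ (Aᵀ *ᵥ v)) i.succ := by
  have h : Q * Aᵀ = (A * Qᵀ)ᵀ := by rw [transpose_mul, transpose_transpose]
  rw [mulVec_mulVec, h]
  simp only [mulVec, dotProduct, transpose_apply, hK]

/-- **key identity in the proof of Proposition 5.** The
prediction residual of the constrained regularized weighted LSE in the
original model equals the prediction residual of the regularized weighted
LSE in the reduced model: `Aθ − Aθ̂^CRWLS = Kα − Kα̂^RWLS`. -/
theorem stmt_14 {M m : ℕ} (A : Matrix (Fin M) (Fin (m + 1)) ℝ)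
    (W : Matrix (Fin M) (Fin M) ℝ) (hW : W.PosDef)
    (t : Fin (m + 1) → ℝ) (ht : t ≠ 0) (γ : ℝ) (hγ : 0 < γ)
    (θ : Fin (m + 1) → ℝ) (hθ : t ⬝ᵥ θ = 1)
    (Q : Matrix (Fin (m + 1)) (Fin (m + 1)) ℝ) (hQ : Qᵀ * Q = 1)
    (hQrow : ∀ j, Q 0 j = t j / Real.sqrt (t ⬝ᵥ t))
    (d : Fin M → ℝ) (hd : ∀ j, d j = (A * Qᵀ) j 0)
    (K : Matrix (Fin M) (Fin m) ℝ) (hK : ∀ j i, K j i = (A * Qᵀ) j i.succ)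
    (α : Fin m → ℝ) (hα : ∀ i, α i = (Q *ᵥ θ) i.succ)
    (z : (Fin M → ℝ) → Fin M → ℝ)
    (hz : ∀ y, z y = y - (Real.sqrt (t ⬝ᵥ t))⁻¹ • d)
    (αRWLS : (Fin M → ℝ) → Fin m → ℝ)
    (hαRWLS : ∀ y, αRWLS y =
      ((Kᵀ * W * K + γ • (1 : Matrix (Fin m) (Fin m) ℝ))⁻¹ * Kᵀ * W) *ᵥ z y)
    (C : Matrix (Fin (m + 1)) (Fin (m + 1)) ℝ)
    (hC : C = (Aᵀ * W * A + γ • (1 : Matrix (Fin (m + 1)) (Fin (m + 1)) ℝ))⁻¹)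
    (θCRWLS : (Fin M → ℝ) → Fin (m + 1) → ℝ)
    (hθCRWLS : ∀ y, θCRWLS y = (C * Aᵀ * W) *ᵥ y -
      ((t ⬝ᵥ (C * Aᵀ * W) *ᵥ y - 1) / (t ⬝ᵥ C *ᵥ t)) • (C *ᵥ t)) :
    ∀ y : Fin M → ℝ,
      A *ᵥ θ - A *ᵥ θCRWLS y = K *ᵥ α - K *ᵥ αRWLS y := by
  intro y
  have h_tt : 0 < t ⬝ᵥ t := by
    simpa using dotProduct_star_self_pos_iff.mpr ht
  set s := Real.sqrt (t ⬝ᵥ t) with hs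
  have hs_pos : 0 < s := Real.sqrt_pos.mpr h_tt
  have hN := posDef_weightedGram_add_smul_one A hW hγ
  have hP := posDef_weightedGram_add_smul_one K hW hγ
  have hNC : (Aᵀ * W * A + γ • (1 : Matrix (Fin (m + 1)) (Fin (m + 1)) ℝ)) * C = 1 := by
    rw [hC]
    exact mul_nonsing_inv _ ((isUnit_iff_isUnit_det _).mp hN.isUnit)
  have h_tCt : t ⬝ᵥ C *ᵥ t ≠ 0 := by
    have h : C.PosDef := hC ▸ hN.inv
    simpa using (h.dotProduct_mulVec_pos ht).ne'
  have h_row : ∀ x, (Q *ᵥ x) 0 = s⁻¹ * (t ⬝ᵥ x) := by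
    intro x
    simp only [mulVec, dotProduct, hQrow, Finset.mul_sum]
    exact Finset.sum_congr rfl fun j _ => by ring
  have h_constraint : t ⬝ᵥ θCRWLS y = 1 := by
    rw [hθCRWLS, dotProduct_sub, dotProduct_smul, smul_eq_mul, div_mul_cancel₀ _ h_tCt]
    ring
  have hQt : ∀ i : Fin m, (Q *ᵥ t) i.succ = 0 := by
    intro i
    have h : (Q * Qᵀ) i.succ 0 = (1 : Matrix (Fin (m + 1)) (Fin (m + 1)) ℝ) i.succ 0 := by
      rw [mul_eq_one_comm.mp hQ]
    rw [one_apply_ne (Fin.succ_ne_zero i)] at h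
    simp only [mul_apply, transpose_apply, hQrow, ← mul_div_assoc, ← Finset.sum_div] at h
    simpa [mulVec, dotProduct, hs_pos.ne'] using h
  obtain ⟨c, hc⟩ : ∃ c : ℝ, Aᵀ *ᵥ (W *ᵥ (A *ᵥ θCRWLS y)) + γ • θCRWLS y =
      Aᵀ *ᵥ (W *ᵥ y) - c • t := by
    refine ⟨(t ⬝ᵥ (C * Aᵀ * W) *ᵥ y - 1) / (t ⬝ᵥ C *ᵥ t), ?_⟩
    have h : (Aᵀ * W * A + γ • (1 : Matrix (Fin (m + 1)) (Fin (m + 1)) ℝ)) *ᵥ θCRWLS y =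
        Aᵀ *ᵥ (W *ᵥ y) -
          ((t ⬝ᵥ (C * Aᵀ * W) *ᵥ y - 1) / (t ⬝ᵥ C *ᵥ t)) • t := by
      rw [hθCRWLS, mulVec_sub, mulVec_smul, mulVec_mulVec, mulVec_mulVec, Matrix.mul_assoc C,
        ← Matrix.mul_assoc _ C, hNC, Matrix.one_mul, one_mulVec, mulVec_mulVec]
    rw [← h, add_mulVec, smul_mulVec, one_mulVec]
    simp only [mulVec_mulVec, Matrix.mul_assoc]
  have h_split := mulVec_eq_smul_add_mulVec_tail A hQ hd hK
  have hα' : α = fun i => (Q *ᵥ θ) i.succ := funext hα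
  set β : Fin m → ℝ := fun i => (Q *ᵥ θCRWLS y) i.succ with hβ
  have hA : A *ᵥ θCRWLS y = s⁻¹ • d + K *ᵥ β := by
    rw [h_split, h_row, h_constraint, mul_one]
  have h_normal : (Kᵀ * W * K + γ • (1 : Matrix (Fin m) (Fin m) ℝ)) *ᵥ β =
      (Kᵀ * W) *ᵥ z y := by
    have h : Kᵀ *ᵥ (W *ᵥ (s⁻¹ • d + K *ᵥ β)) + γ • β = Kᵀ *ᵥ (W *ᵥ y) := by
      rw [← hA]
      ext i
      have hi := congrFun (congrArg (Q *ᵥ ·) hc) i.succ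
      simp only [mulVec_add, mulVec_sub, mulVec_smul, Pi.add_apply, Pi.sub_apply,
        Pi.smul_apply, hQt, smul_zero, sub_zero] at hi
      rw [Pi.add_apply, Pi.smul_apply, transpose_mulVec_eq_tail A Q hK,
        transpose_mulVec_eq_tail A Q hK]
      exact hi
    rw [hz, add_mulVec, smul_mulVec, one_mulVec, ← mulVec_mulVec, ← mulVec_mulVec,
      ← mulVec_mulVec, mulVec_sub, mulVec_sub, ← h, mulVec_add, mulVec_add]
    abel
  have hβ_eq : αRWLS y = β := by
    rw [hαRWLS, Matrix.mul_assoc, ← mulVec_mulVec, ← h_normal, mulVec_mulVec,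
      nonsing_inv_mul _ ((isUnit_iff_isUnit_det _).mp hP.isUnit), one_mulVec]
  rw [hA, hβ_eq, h_split θ, h_row, hθ, mul_one, ← hα']
  abel
end

section
/- Let k = m+1, A a real M×k matrix, W symmetric positive definite, t ∈ ℝ^k nonzero, and γ ≥ 0 such that both AᵀWA + γI and KᵀWK + γI are invertible. Let Q be a real orthogonal k×k matrix whose row indexed 0 equals tᵀ/‖t‖, and write A·Qᵀ = [d, K] (d the column indexed 0, K the remaining M×m block). Put C = (AᵀWA + γI)⁻¹, H = C AᵀW − C t·(tᵀC AᵀW)/(tᵀC t), f = C t/(tᵀC t), V = (KᵀWK + γI)⁻¹, U = V KᵀW. Then: (i) the row of Q·H indexed 0 is the zero row and the remaining rows of Q·H coincide with U (i.e. (Q·H)_{i+1} = U_i for each i); and (ii) the vector Q·f has component 1/‖t‖ at index 0 and components −(U·d)_i/‖t‖ at the remaining indices. -/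
open Matrix

/-- If `x` solves the regularized normal equations of `A` up to a multiple of `t`, and row `0` of
the orthogonal matrix `Q` is proportional to `t`, then the coordinates of `Q x` other than the first
solve the regularized normal equations of the reduced model. -/
theorem reduced_normal_equations {M m : ℕ} {A : Matrix (Fin M) (Fin (m + 1)) ℝ}
    {W : Matrix (Fin M) (Fin M) ℝ} {t : Fin (m + 1) → ℝ} {γ : ℝ}
    {Q : Matrix (Fin (m + 1)) (Fin (m + 1)) ℝ} (hQ : Qᵀ * Q = 1) {r : ℝ} (ht : t = r • Q 0)
    {d : Fin M → ℝ} (hd : ∀ j, d j = (A * Qᵀ) j 0)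
    {K : Matrix (Fin M) (Fin m) ℝ} (hK : ∀ j i, K j i = (A * Qᵀ) j i.succ)
    {x : Fin (m + 1) → ℝ} {y : Fin M → ℝ} {c : ℝ}
    (hx : (Aᵀ * W * A + γ • (1 : Matrix (Fin (m + 1)) (Fin (m + 1)) ℝ)) *ᵥ x =
      Aᵀ *ᵥ (W *ᵥ y) + c • t) :
    (Kᵀ * W * K + γ • (1 : Matrix (Fin m) (Fin m) ℝ)) *ᵥ (fun i => (Q *ᵥ x) i.succ) =
      Kᵀ *ᵥ (W *ᵥ (y - (Q *ᵥ x) 0 • d)) := by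
  have hAx : A *ᵥ x = (Q *ᵥ x) 0 • d + K *ᵥ (fun i => (Q *ᵥ x) i.succ) := by
    have h : A *ᵥ x = (A * Qᵀ) *ᵥ (Q *ᵥ x) := by
      rw [mulVec_mulVec, Matrix.mul_assoc, hQ, Matrix.mul_one]
    rw [h]
    ext j
    simp [mulVec, dotProduct, Fin.sum_univ_succ, hd, hK, mul_comm]
  have hsucc (v : Fin M → ℝ) (i : Fin m) : (Q *ᵥ (Aᵀ *ᵥ v)) i.succ = (Kᵀ *ᵥ v) i := by
    have h : Q * Aᵀ = (A * Qᵀ)ᵀ := by simp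
    rw [mulVec_mulVec, h]
    simp [mulVec, dotProduct, hK]
  have hQt (i : Fin m) : (Q *ᵥ t) i.succ = 0 := by
    have h : (Q * Qᵀ) i.succ 0 = 0 := by
      rw [mul_eq_one_comm.mp hQ, one_apply_ne (Fin.succ_ne_zero i)]
    rw [ht, mulVec_smul]
    have h' : (Q *ᵥ Q 0) i.succ = 0 := by
      simpa [mul_apply, mulVec, dotProduct] using h
    simp [h']
  ext i
  have h := congrFun (congrArg (fun v => Q *ᵥ v) hx) i.succ
  simp only [add_mulVec, ← mulVec_mulVec, smul_mulVec, one_mulVec, mulVec_add, mulVec_smul,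
    Pi.add_apply, Pi.smul_apply, hsucc, hQt, hAx, smul_eq_mul] at h
  simp only [add_mulVec, ← mulVec_mulVec, smul_mulVec, one_mulVec, mulVec_sub, mulVec_smul,
    Pi.add_apply, Pi.sub_apply, Pi.smul_apply, smul_eq_mul]
  linarith

/-- **Lemma B1.** The affine representation
`θ̂^CRWLS = H y + f` transforms under the orthogonal change of coordinates
`Q` (row 0 proportional to `t`) into the regularized weighted LSE of the
reduced model: row 0 of `QH` vanishes and the remaining rows equal `U`,
while `Qf` has entry `1/‖t‖` at index 0 and entries `−(Ud)ᵢ/‖t‖` below. -/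
theorem stmt_18 {M m : ℕ} (A : Matrix (Fin M) (Fin (m + 1)) ℝ)
    (W : Matrix (Fin M) (Fin M) ℝ) (hW : W.PosDef)
    (t : Fin (m + 1) → ℝ) (ht : t ≠ 0) (γ : ℝ) (hγ : 0 ≤ γ)
    (Q : Matrix (Fin (m + 1)) (Fin (m + 1)) ℝ) (hQ : Qᵀ * Q = 1)
    (hQrow : ∀ j, Q 0 j = t j / Real.sqrt (t ⬝ᵥ t))
    (d : Fin M → ℝ) (hd : ∀ j, d j = (A * Qᵀ) j 0)
    (K : Matrix (Fin M) (Fin m) ℝ) (hK : ∀ j i, K j i = (A * Qᵀ) j i.succ)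
    (hinvA : IsUnit (Aᵀ * W * A + γ • (1 : Matrix (Fin (m + 1)) (Fin (m + 1)) ℝ)))
    (hinvK : IsUnit (Kᵀ * W * K + γ • (1 : Matrix (Fin m) (Fin m) ℝ)))
    (C : Matrix (Fin (m + 1)) (Fin (m + 1)) ℝ)
    (hC : C = (Aᵀ * W * A + γ • (1 : Matrix (Fin (m + 1)) (Fin (m + 1)) ℝ))⁻¹)
    (H : Matrix (Fin (m + 1)) (Fin M) ℝ)
    (hH : H = C * Aᵀ * W -
      (t ⬝ᵥ C *ᵥ t)⁻¹ • (C * vecMulVec t t * C * Aᵀ * W))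
    (f : Fin (m + 1) → ℝ) (hf : f = (t ⬝ᵥ C *ᵥ t)⁻¹ • (C *ᵥ t))
    (V : Matrix (Fin m) (Fin m) ℝ)
    (hV : V = (Kᵀ * W * K + γ • (1 : Matrix (Fin m) (Fin m) ℝ))⁻¹)
    (U : Matrix (Fin m) (Fin M) ℝ) (hU : U = V * Kᵀ * W) :
    ((∀ j, (Q * H) 0 j = 0) ∧ (∀ i j, (Q * H) i.succ j = U i j)) ∧
      ((Q *ᵥ f) 0 = (Real.sqrt (t ⬝ᵥ t))⁻¹ ∧
        ∀ i, (Q *ᵥ f) i.succ = -((U *ᵥ d) i) / Real.sqrt (t ⬝ᵥ t)) := by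
  set G := Aᵀ * W * A + γ • (1 : Matrix (Fin (m + 1)) (Fin (m + 1)) ℝ) with hG
  have hGdet := (isUnit_iff_isUnit_det _).mp hinvA
  have hGC : G * C = 1 := by rw [hC, mul_nonsing_inv _ hGdet]
  have hVdet := (isUnit_iff_isUnit_det _).mp hinvK
  have hGpos : G.PosDef := by
    have h : G.PosSemidef := by
      refine PosSemidef.add ?_ (PosSemidef.one.smul hγ)
      simpa using hW.posSemidef.conjTranspose_mul_mul_same A
    exact h.posDef_iff_isUnit.mpr hinvA
  have hs : t ⬝ᵥ C *ᵥ t ≠ 0 := by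
    have h : C.PosDef := hC ▸ hGpos.inv
    simpa using (h.dotProduct_mulVec_pos ht).ne'
  set s := t ⬝ᵥ C *ᵥ t with hs_def
  set r := Real.sqrt (t ⬝ᵥ t) with hr_def
  have hr : r ≠ 0 := by
    have h : 0 < t ⬝ᵥ t := by simpa using dotProduct_star_self_pos_iff.mpr ht
    exact (Real.sqrt_pos.mpr h).ne'
  have htQ : t = r • Q 0 := by
    ext j
    rw [Pi.smul_apply, hQrow, smul_eq_mul, mul_div_cancel₀ _ hr]
  have hQ0 (x : Fin (m + 1) → ℝ) : (Q *ᵥ x) 0 = (t ⬝ᵥ x) / r := by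
    simp only [mulVec, dotProduct, hQrow, Finset.sum_div]
    exact Finset.sum_congr rfl fun j _ => by ring
  have hsolve {z w : Fin m → ℝ}
      (h : (Kᵀ * W * K + γ • (1 : Matrix (Fin m) (Fin m) ℝ)) *ᵥ z = w) : z = V *ᵥ w := by
    rw [← h, mulVec_mulVec, hV, nonsing_inv_mul _ hVdet, one_mulVec]
  have hHy (y : Fin M → ℝ) : H *ᵥ y =
      C *ᵥ (Aᵀ *ᵥ (W *ᵥ y)) - (s⁻¹ * (t ⬝ᵥ C *ᵥ (Aᵀ *ᵥ (W *ᵥ y)))) • (C *ᵥ t) := by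
    simp only [hH, sub_mulVec, smul_mulVec, ← mulVec_mulVec, vecMulVec_mulVec, mulVec_smul,
      op_smul_eq_smul, smul_smul]
  have hHy0 (y : Fin M → ℝ) : (Q *ᵥ (H *ᵥ y)) 0 = 0 := by
    rw [hQ0, hHy, dotProduct_sub, dotProduct_smul, ← hs_def, smul_eq_mul]
    field_simp
    ring
  have hHysucc (y : Fin M → ℝ) : (fun i => (Q *ᵥ (H *ᵥ y)) i.succ) = U *ᵥ y := by
    have h := hsolve <| reduced_normal_equations (γ := γ) (W := W) hQ htQ hd hK (x := H *ᵥ y)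
      (y := y) (c := -(s⁻¹ * (t ⬝ᵥ C *ᵥ (Aᵀ *ᵥ (W *ᵥ y))))) (by
        rw [← hG, hHy, mulVec_sub, mulVec_smul, mulVec_mulVec _ G C, mulVec_mulVec _ G C, hGC,
          one_mulVec, one_mulVec, neg_smul, sub_eq_add_neg])
    rw [h, hHy0, zero_smul, sub_zero, hU, mulVec_mulVec, mulVec_mulVec, Matrix.mul_assoc]
  have hf0 : (Q *ᵥ f) 0 = r⁻¹ := by
    rw [hQ0, hf, dotProduct_smul, ← hs_def, smul_eq_mul, inv_mul_cancel₀ hs, one_div]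
  have hfsucc : (fun i => (Q *ᵥ f) i.succ) = U *ᵥ (-(r⁻¹ • d)) := by
    have h := hsolve <| reduced_normal_equations (γ := γ) (W := W) hQ htQ hd hK (x := f)
      (y := 0) (c := s⁻¹) (by
        rw [← hG, hf, mulVec_smul, mulVec_mulVec, hGC, one_mulVec, mulVec_zero, mulVec_zero,
          zero_add])
    rw [h, hf0, zero_sub, hU, mulVec_mulVec, mulVec_mulVec, Matrix.mul_assoc]
  have hcol {n : ℕ} (B : Matrix (Fin n) (Fin M) ℝ) (i : Fin n) (j : Fin M) :
      B i j = (B *ᵥ Pi.single j 1) i := by simp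
  refine ⟨⟨fun j => ?_, fun i j => ?_⟩, hf0, fun i => ?_⟩
  · rw [hcol (Q * H), ← mulVec_mulVec, hHy0]
  · rw [hcol (Q * H), ← mulVec_mulVec, hcol U]
    exact congrFun (hHysucc _) i
  · rw [congrFun hfsucc i, mulVec_neg, mulVec_smul, Pi.neg_apply, Pi.smul_apply, smul_eq_mul]
    ring
end

section
/- Let k = m+1, let A be a real M×k matrix of full column rank k, W a symmetric positive definite real M×M matrix, and t ∈ ℝ^k nonzero. Let Q be a real orthogonal k×k matrix whose row indexed 0 equals tᵀ/‖t‖, and write A·Qᵀ = [d, K] with K the M×m block of columns indexed ≠ 0 (so KᵀWK is invertible). Write G = (AᵀWA)⁻¹. Then: (i) tr((KᵀWK)⁻¹) = tr(G) − tᵀG²t/(tᵀG t); and (ii) for every θ ∈ ℝ^k, letting α ∈ ℝ^m be the vector of components (Qθ)_i for i ≠ 0, αᵀ(KᵀWK)⁻¹α = θᵀGθ − (θᵀG t)·(tᵀG θ)/(tᵀG t). Equivalently, Qᵀ·blockdiag(0, (KᵀWK)⁻¹)·Q = G − G t tᵀ G/(tᵀ G t). -/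
open Matrix

namespace Matrix

theorem mulVec_injective_of_rank_eq_card_s19 {R m n : Type*} [Field R] [Fintype m] [Fintype n]
    (A : Matrix m n R) (h : A.rank = Fintype.card n) : Function.Injective A.mulVec := by
  rw [mulVec_injective_iff, linearIndependent_iff_card_eq_finrank_span, ← h,
    rank_eq_finrank_span_cols]
  rfl

section RankOneCorrection

variable {R n : Type*} [Field R] [Fintype n]

/-- The rank-one downdate `G - G t tᵀ G / (tᵀ G t)`. -/
def rankOneDowndate (G : Matrix n n R) (t : n → R) : Matrix n n R :=
  G - (t ⬝ᵥ G *ᵥ t)⁻¹ • vecMulVec (G *ᵥ t) (t ᵥ* G)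

variable {G : Matrix n n R} {t : n → R}

theorem rankOneDowndate_mulVec_self (h : t ⬝ᵥ G *ᵥ t ≠ 0) :
    rankOneDowndate G t *ᵥ t = 0 := by
  ext i
  simp [rankOneDowndate, sub_mulVec, smul_mulVec, vecMulVec_mulVec, ← dotProduct_mulVec]
  field_simp
  simp

theorem vecMul_rankOneDowndate_self (h : t ⬝ᵥ G *ᵥ t ≠ 0) :
    t ᵥ* rankOneDowndate G t = 0 := by
  ext i
  simp [rankOneDowndate, vecMul_sub, vecMul_smul, vecMul_vecMulVec]
  field_simp
  simp

theorem trace_rankOneDowndate (G : Matrix n n R) (t : n → R) :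
    (rankOneDowndate G t).trace = G.trace - (t ⬝ᵥ (G * G) *ᵥ t) / (t ⬝ᵥ G *ᵥ t) := by
  rw [rankOneDowndate, trace_sub, trace_smul, trace_vecMulVec, dotProduct_comm (G *ᵥ t),
    ← dotProduct_mulVec, mulVec_mulVec, smul_eq_mul, inv_mul_eq_div]

theorem dotProduct_rankOneDowndate_mulVec (G : Matrix n n R) (t x : n → R) :
    x ⬝ᵥ rankOneDowndate G t *ᵥ x =
      x ⬝ᵥ G *ᵥ x - (x ⬝ᵥ G *ᵥ t) * (t ⬝ᵥ G *ᵥ x) / (t ⬝ᵥ G *ᵥ t) := by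
  simp [rankOneDowndate, sub_mulVec, smul_mulVec, vecMulVec_mulVec, ← dotProduct_mulVec,
    dotProduct_sub]
  ring

theorem mul_rankOneDowndate [DecidableEq n] {N : Matrix n n R} (h : N * G = 1) :
    N * rankOneDowndate G t = 1 - (t ⬝ᵥ G *ᵥ t)⁻¹ • vecMulVec t (t ᵥ* G) := by
  rw [rankOneDowndate, Matrix.mul_sub, Matrix.mul_smul, mul_vecMulVec, mulVec_mulVec, h,
    one_mulVec]

end RankOneCorrection

end Matrix


/-- **Lemma B3.** With `G = (AᵀWA)⁻¹` and the orthogonal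
change of coordinates `Q` (row 0 proportional to `t`), `A Qᵀ = [d, K]`:
(i) `tr((KᵀWK)⁻¹) = tr(G) − tᵀG²t/(tᵀGt)`, and
(ii) for every `θ`, with `α` the reduced coordinates of `θ`,
`αᵀ(KᵀWK)⁻¹α = θᵀGθ − (θᵀGt)(tᵀGθ)/(tᵀGt)`. -/
theorem stmt_19 {M m : ℕ} (A : Matrix (Fin M) (Fin (m + 1)) ℝ)
    (hA : A.rank = m + 1)
    (W : Matrix (Fin M) (Fin M) ℝ) (hW : W.PosDef)
    (t : Fin (m + 1) → ℝ) (ht : t ≠ 0)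
    (Q : Matrix (Fin (m + 1)) (Fin (m + 1)) ℝ) (hQ : Qᵀ * Q = 1)
    (hQrow : ∀ j, Q 0 j = t j / Real.sqrt (t ⬝ᵥ t))
    (d : Fin M → ℝ) (hd : ∀ j, d j = (A * Qᵀ) j 0)
    (K : Matrix (Fin M) (Fin m) ℝ) (hK : ∀ j i, K j i = (A * Qᵀ) j i.succ)
    (G : Matrix (Fin (m + 1)) (Fin (m + 1)) ℝ) (hG : G = (Aᵀ * W * A)⁻¹) :
    ((Kᵀ * W * K)⁻¹.trace =
      G.trace - (t ⬝ᵥ (G * G) *ᵥ t) / (t ⬝ᵥ G *ᵥ t)) ∧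
    ∀ θ : Fin (m + 1) → ℝ, ∀ α : Fin m → ℝ,
      (∀ i, α i = (Q *ᵥ θ) i.succ) →
      α ⬝ᵥ (Kᵀ * W * K)⁻¹ *ᵥ α =
        θ ⬝ᵥ G *ᵥ θ - (θ ⬝ᵥ G *ᵥ t) * (t ⬝ᵥ G *ᵥ θ) / (t ⬝ᵥ G *ᵥ t) := by
  have hQ' : Q * Qᵀ = 1 := mul_eq_one_comm.mp hQ
  have hpos : (Aᵀ * W * A).PosDef := by
    simpa using hW.conjTranspose_mul_mul_same
      (mulVec_injective_of_rank_eq_card_s19 A (by simpa using hA))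
  have hNG : Aᵀ * W * A * G = 1 := by
    rw [hG]
    exact mul_nonsing_inv _ ((isUnit_iff_isUnit_det _).mp hpos.isUnit)
  have htGt : t ⬝ᵥ G *ᵥ t ≠ 0 := by
    rw [hG]
    simpa using (hpos.inv.dotProduct_mulVec_pos ht).ne'
  have hsq : Real.sqrt (t ⬝ᵥ t) ≠ 0 := by
    have := dotProduct_star_self_pos_iff.mpr ht
    exact (Real.sqrt_pos.mpr (by simpa using this)).ne'
  have hQ0 : Q 0 = (Real.sqrt (t ⬝ᵥ t))⁻¹ • t := by
    ext j
    simp [hQrow, div_eq_inv_mul]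
  have hQt : ∀ i : Fin m, (Q *ᵥ t) i.succ = 0 := by
    intro i
    have h := congrFun₂ hQ' i.succ 0
    have h' : Q i.succ ⬝ᵥ Q 0 = 0 := by
      simpa [mul_apply, dotProduct] using h
    simpa [hQ0, hsq, mulVec] using h'
  set T := rankOneDowndate G t with hT
  set S := Q * T * Qᵀ with hS
  have hS0 : ∀ j, S 0 j = 0 := by
    intro j
    rw [hS, Matrix.mul_assoc, mul_apply_eq_vecMul, hQ0, smul_vecMul, ← vecMul_vecMul,
      vecMul_rankOneDowndate_self htGt]
    simp
  have hS0' : ∀ i, S i 0 = 0 := by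
    intro i
    have : S i 0 = (S *ᵥ Pi.single 0 1) i := by simp
    have hcol : Qᵀ *ᵥ Pi.single 0 1 = (Real.sqrt (t ⬝ᵥ t))⁻¹ • t := by
      rw [← hQ0]
      ext j
      simp
    rw [this, hS, ← mulVec_mulVec, ← mulVec_mulVec, hcol, mulVec_smul,
      rankOneDowndate_mulVec_self htGt]
    simp
  have hK' : K = (A * Qᵀ).submatrix id Fin.succ := by
    ext j i
    exact hK j i
  have hB : Kᵀ * W * K = (Q * (Aᵀ * W * A) * Qᵀ).submatrix Fin.succ Fin.succ := by
    have : Q * (Aᵀ * W * A) * Qᵀ = (A * Qᵀ)ᵀ * W * (A * Qᵀ) := by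
      simp [transpose_mul, Matrix.mul_assoc]
    rw [this, hK']
    rfl
  have hBS : Q * (Aᵀ * W * A) * Qᵀ * S =
      1 - (t ⬝ᵥ G *ᵥ t)⁻¹ • vecMulVec (Q *ᵥ t) (t ᵥ* G ᵥ* Qᵀ) := by
    calc _ = Q * (Aᵀ * W * A) * (Qᵀ * Q) * T * Qᵀ := by simp only [hS, Matrix.mul_assoc]
      _ = Q * (Aᵀ * W * A * T) * Qᵀ := by simp only [hQ, Matrix.mul_one, Matrix.mul_assoc]
      _ = _ := by
        rw [mul_rankOneDowndate hNG, Matrix.mul_sub, Matrix.sub_mul, Matrix.mul_one, hQ',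
          Matrix.mul_smul, Matrix.smul_mul, mul_vecMulVec, vecMulVec_mul]
  have hinv : (Kᵀ * W * K)⁻¹ = S.submatrix Fin.succ Fin.succ := by
    refine inv_eq_right_inv ?_
    ext i j
    have h := congrFun₂ hBS i.succ j.succ
    rw [mul_apply, Fin.sum_univ_succ, hS0, mul_zero, zero_add] at h
    rw [hB, mul_apply]
    simpa [vecMulVec_apply, hQt, one_apply] using h
  constructor
  · have h : S.trace = T.trace := by
      rw [hS, trace_mul_comm, ← Matrix.mul_assoc, hQ, Matrix.one_mul]
    rw [hinv, ← trace_rankOneDowndate, ← hT, ← h]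
    simp [trace, Fin.sum_univ_succ, hS0]
  · intro θ α hα
    have h : (Q *ᵥ θ) ⬝ᵥ S *ᵥ (Q *ᵥ θ) = θ ⬝ᵥ T *ᵥ θ := by
      rw [hS, ← vecMul_transpose, ← dotProduct_mulVec, vecMul_transpose, mulVec_mulVec,
        mulVec_mulVec]
      congr 2
      calc _ = (Qᵀ * Q) * T * (Qᵀ * Q) := by simp only [Matrix.mul_assoc]
        _ = T := by simp [hQ]
    rw [hinv, ← dotProduct_rankOneDowndate_mulVec, ← hT, ← h]
    simp [dotProduct, mulVec, Fin.sum_univ_succ, hS0, hS0']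
    simp [hα, mulVec, dotProduct, Fin.sum_univ_succ]
end
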